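/- Let N be a stable matching in a Stable Roommates instance and let e = {a, b} ∉ N be a stable pair such that both a and b are matched in N. Then exactly one of the following holds: (i) N(a) ≻_a b and a ≻_b N(b); or (ii) b ≻_a N(a) and N(b) ≻_b a. -/

import Mathlib

section SRDefs

variable {A : Type*}

/-- A matching in a Stable Roommates instance with acceptability `acc`:
a set of unordered pairs of mutually acceptable agents, each agent in at most one pair. -/
def IsSRMatching (acc : A → A → Prop) (M : Finset (Sym2 A)) : Prop :=
  (∀ a b : A, s(a, b) ∈ M → acc a b) ∧
  (∀ a b c : A, s(a, b) ∈ M → s(a, c) ∈ M → b = c)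

def Matched (M : Finset (Sym2 A)) (a : A) : Prop := ∃ b, s(a, b) ∈ M

/-- A pair `{a, b}` of acceptable agents blocks `M`: each of the two agents is
unmatched or strictly prefers the other to its partner (smaller rank = better). -/
def SRBlocks (acc : A → A → Prop) (rk : A → A → ℕ) (M : Finset (Sym2 A)) (a b : A) : Prop :=
  acc a b ∧
  (¬ Matched M a ∨ ∃ c, s(a, c) ∈ M ∧ rk a b < rk a c) ∧
  (¬ Matched M b ∨ ∃ c, s(b, c) ∈ M ∧ rk b a < rk b c)

/-- A stable matching: a matching not blocked by any pair. -/
def IsStable (acc : A → A → Prop) (rk : A → A → ℕ) (M : Finset (Sym2 A)) : Prop :=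
  IsSRMatching acc M ∧ ∀ a b, ¬ SRBlocks acc rk M a b

end SRDefs

/-- Agents matched in `M` and strictly preferring `M` to `N`. -/
def PrefSet {A : Type*} (rk : A → A → ℕ) (M N : Finset (Sym2 A)) : Set A :=
  {x | ∃ y, s(x, y) ∈ M ∧ ∀ z, s(x, z) ∈ N → rk x y < rk x z}

lemma prefSet_finite {A : Type*} [DecidableEq A] (rk : A → A → ℕ) (M N : Finset (Sym2 A)) :
    (PrefSet rk M N).Finite := by
  apply (M.biUnion Sym2.toFinset).finite_toSet.subset
  rintro x ⟨y, hy, -⟩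
  simp only [Finset.coe_biUnion, Set.mem_iUnion]
  exact ⟨s(x, y), hy, by simp⟩

lemma prefSet_step {A : Type*} (acc : A → A → Prop)
    (hsym : ∀ a b, acc a b → acc b a) (rk : A → A → ℕ)
    (hstrict : ∀ a b c, acc a b → acc a c → rk a b = rk a c → b = c)
    (M N : Finset (Sym2 A)) (hM : IsStable acc rk M) (hN : IsStable acc rk N)
    (x y : A) (hx : x ∈ PrefSet rk M N) (hxy : s(x, y) ∈ M) : y ∈ PrefSet rk N M := by
  obtain ⟨y', hy', h⟩ := hx
  obtain rfl := hM.1.2 _ _ _ hxy hy'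
  have hyx : s(y, x) ∈ M := by rwa [Sym2.eq_swap]
  have hacc := hM.1.1 _ _ hxy
  have hxside : ¬ Matched N x ∨ ∃ c, s(x, c) ∈ N ∧ rk x y < rk x c := by
    by_cases hm : Matched N x
    · obtain ⟨c, hc⟩ := hm
      exact Or.inr ⟨c, hc, h c hc⟩
    · exact Or.inl hm
  have hy : ¬ (¬ Matched N y ∨ ∃ c, s(y, c) ∈ N ∧ rk y x < rk y c) :=
    fun hh => hN.2 x y ⟨hacc, hxside, hh⟩
  rw [not_or, not_not] at hy
  obtain ⟨⟨z, hz⟩, h2⟩ := hy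
  refine ⟨z, hz, fun w hw => ?_⟩
  obtain rfl := hM.1.2 _ _ _ hyx hw
  have hle : rk y z ≤ rk y x := by
    by_contra hlt
    exact h2 ⟨z, hz, not_le.mp hlt⟩
  refine lt_of_le_of_ne hle fun he => ?_
  obtain rfl := hstrict _ _ _ (hN.1.1 _ _ hz) (hsym _ _ hacc) he
  rw [Sym2.eq_swap] at hz
  exact lt_irrefl _ (h _ hz)

lemma prefSet_card {A : Type*} [DecidableEq A] (acc : A → A → Prop)
    (hsym : ∀ a b, acc a b → acc b a) (rk : A → A → ℕ)
    (hstrict : ∀ a b c, acc a b → acc a c → rk a b = rk a c → b = c)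
    (M N : Finset (Sym2 A)) (hM : IsStable acc rk M) (hN : IsStable acc rk N)
    (T : Set A) (hT : T.Finite)
    (hsub : ∀ x y, x ∈ PrefSet rk M N → s(x, y) ∈ M → y ∈ T) :
    (PrefSet rk M N).ncard ≤ T.ncard := by
  have hp : ∀ x, ∃ y, x ∈ PrefSet rk M N → s(x, y) ∈ M := by
    intro x
    by_cases hx : x ∈ PrefSet rk M N
    · obtain ⟨y, hy, -⟩ := hx
      exact ⟨y, fun _ => hy⟩
    · exact ⟨x, fun h => absurd h hx⟩
  choose f hf using hp
  refine Set.ncard_le_ncard_of_injOn f (fun x hx => hsub x _ hx (hf x hx)) ?_ hT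
  intro x hx x' hx' he
  have h1 := hf x hx
  have h2 := hf x' hx'
  rw [← he] at h2
  rw [Sym2.eq_swap] at h1 h2
  exact hM.1.2 _ _ _ h1 h2

/-- Gusfield–Irving, Lemma 4.3.9. In a Stable Roommates instance
with strict preferences, if `N` is a stable matching and `e = {a, b} ∉ N` is a
stable pair with both endpoints matched in `N` (to `a'` resp. `b'`), then exactly
one of the following holds: (i) `N(a) ≻_a b` and `a ≻_b N(b)`; or
(ii) `b ≻_a N(a)` and `N(b) ≻_b a`. -/
theorem stmt8 {A : Type*} [DecidableEq A]
    (acc : A → A → Prop)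
    (hirr : ∀ a, ¬ acc a a)
    (hsym : ∀ a b, acc a b → acc b a)
    (rk : A → A → ℕ)
    (hstrict : ∀ a b c, acc a b → acc a c → rk a b = rk a c → b = c)
    (N : Finset (Sym2 A)) (hN : IsStable acc rk N)
    (a b : A)
    (hstablePair : ∃ M, IsStable acc rk M ∧ s(a, b) ∈ M)
    (hnotN : s(a, b) ∉ N)
    (a' b' : A) (ha' : s(a, a') ∈ N) (hb' : s(b, b') ∈ N) :
    Xor' (rk a a' < rk a b ∧ rk b a < rk b b') (rk a b < rk a a' ∧ rk b b' < rk b a) := by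
  obtain ⟨M, hM, hab⟩ := hstablePair
  have hba : s(b, a) ∈ M := by rwa [Sym2.eq_swap]
  have hne : rk a b ≠ rk a a' := fun he => by
    obtain rfl := hstrict _ _ _ (hM.1.1 _ _ hab) (hN.1.1 _ _ ha') he
    exact hnotN ha'
  have key1 : rk a b < rk a a' → rk b b' < rk b a := fun h => by
    have h1 : a ∈ PrefSet rk M N := ⟨b, hab, fun z hz => by
      rwa [← hN.1.2 _ _ _ ha' hz]⟩
    obtain ⟨w, hw, h2⟩ := prefSet_step acc hsym rk hstrict M N hM hN a b h1 hab
    rw [hN.1.2 _ _ _ hb' hw]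
    exact h2 a hba
  have key2 : rk a a' < rk a b → rk b a < rk b b' := fun h => by
    have h1 : a ∈ PrefSet rk N M := ⟨a', ha', fun z hz => by
      rwa [← hM.1.2 _ _ _ hab hz]⟩
    by_contra hcon
    have hfin := prefSet_finite rk N M
    have c1 := prefSet_card acc hsym rk hstrict N M hN hM _ (prefSet_finite rk M N)
      (prefSet_step acc hsym rk hstrict N M hN hM)
    have c2 := prefSet_card acc hsym rk hstrict M N hM hN (PrefSet rk N M \ {a})
      (hfin.subset Set.diff_subset) (fun x y hx hxy => by
        refine ⟨prefSet_step acc hsym rk hstrict M N hM hN x y hx hxy, ?_⟩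
        rintro rfl
        have hyx : s(y, x) ∈ M := by rwa [Sym2.eq_swap]
        obtain rfl := hM.1.2 _ _ _ hab hyx
        obtain ⟨w, hw, h3⟩ := hx
        obtain rfl := hM.1.2 _ _ _ hxy hw
        exact hcon (h3 b' hb'))
    have c3 := Set.ncard_diff_singleton_lt_of_mem h1 hfin
    omega
  rcases lt_or_gt_of_ne hne with h | h
  · exact Or.inr ⟨⟨h, key1 h⟩, fun h' => by omega⟩
  · exact Or.inl ⟨⟨h, key2 h⟩, fun h' => by omega⟩
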